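/- For any window size W ≥ 0, LB_Keogh_W(A,B) = Σ_{i=1}^{L} κ_i ≤ DTW²_W(A,B). -/

import Mathlib

noncomputable section

/-- Squared pointwise cost. -/
def delta (x y : ℝ) : ℝ := (x - y) ^ 2

/-- Continuity/monotonicity step of a warping path. -/
def Step (q r : ℕ × ℕ) : Prop :=
  r = (q.1 + 1, q.2) ∨ r = (q.1, q.2 + 1) ∨ r = (q.1 + 1, q.2 + 1)

/-- A `W`-warping path for series of length `L` (1-based indices). -/
def IsWarpingPath (L W : ℕ) (p : List (ℕ × ℕ)) : Prop :=
  p.head? = some (1, 1) ∧ p.getLast? = some (L, L) ∧ List.Chain' Step p ∧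
    ∀ q ∈ p, 1 ≤ q.1 ∧ q.1 ≤ L ∧ 1 ≤ q.2 ∧ q.2 ≤ L ∧ ((q.1 : ℤ) - (q.2 : ℤ)).natAbs ≤ W

/-- Cost of a warping path. -/
def pathCost (A B : ℕ → ℝ) (p : List (ℕ × ℕ)) : ℝ :=
  (p.map (fun q => delta (A q.1) (B q.2))).sum

/-- `DTW²_W(A,B)`: minimum cost over all `W`-warping paths. -/
def DTW2 (L W : ℕ) (A B : ℕ → ℝ) : ℝ :=
  sInf (pathCost A B '' {p | IsWarpingPath L W p})

/-- Left band `ℒ^W_i`. -/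
def leftBand (W i : ℕ) : Finset (ℕ × ℕ) :=
  (Finset.Icc (max 1 (i - W)) i).image (fun j => (j, i)) ∪
    (Finset.Icc (max 1 (i - W)) i).image (fun k => (i, k))

/-- Right band `ℛ^W_i`. -/
def rightBand (L W i : ℕ) : Finset (ℕ × ℕ) :=
  (Finset.Icc i (min L (i + W))).image (fun j => (j, i)) ∪
    (Finset.Icc i (min L (i + W))).image (fun k => (i, k))

/-- Vertical band `𝒱_i`. -/
def vertBand (L W i : ℕ) : Finset (ℕ × ℕ) :=
  (Finset.Icc (max 1 (i - W)) (min L (i + W))).image (fun j => (i, j))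

/-- Minimum of `δ(A_j, B_k)` over a (finite, nonempty) band of pairs `(j,k)`. -/
def bandMin (A B : ℕ → ℝ) (s : Finset (ℕ × ℕ)) : ℝ :=
  sInf ((fun q => delta (A q.1) (B q.2)) '' (s : Set (ℕ × ℕ)))

/-- Upper envelope `𝕌^B_i`. -/
def upperEnv (L W : ℕ) (B : ℕ → ℝ) (i : ℕ) : ℝ :=
  sSup (B '' Set.Icc (max 1 (i - W)) (min L (i + W)))

/-- Lower envelope `𝕃^B_i`. -/
def lowerEnv (L W : ℕ) (B : ℕ → ℝ) (i : ℕ) : ℝ :=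
  sInf (B '' Set.Icc (max 1 (i - W)) (min L (i + W)))

/-- LB_Keogh term `κ_i`. -/
def kappa (L W : ℕ) (A B : ℕ → ℝ) (i : ℕ) : ℝ :=
  if upperEnv L W B i < A i then delta (A i) (upperEnv L W B i)
  else if A i < lowerEnv L W B i then delta (A i) (lowerEnv L W B i)
  else 0
/-- If every step of a list of pairs raises the first coordinate by at most one, then summing `f`
over the first coordinates visited is bounded by summing any nonnegative `c` dominating `f`. -/
theorem sum_Icc_le_sum_map_of_isChain_step {f : ℕ → ℝ} {c : ℕ × ℕ → ℝ} {n : ℕ} :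
    ∀ (p : List (ℕ × ℕ)) (q : ℕ × ℕ), List.IsChain Step (q :: p) →
      (∃ b, (q :: p).getLast? = some (n, b)) →
      (∀ r ∈ q :: p, r.1 ≤ n ∧ f r.1 ≤ c r ∧ 0 ≤ c r) →
      ∑ i ∈ Finset.Icc q.1 n, f i ≤ ((q :: p).map c).sum := by
  intro p
  induction p with
  | nil =>
    rintro q - ⟨b, hb⟩ h
    obtain rfl : q = (n, b) := by simpa using hb
    simpa using (h (n, b) (by simp)).2.1
  | cons r t ih =>
    rintro q hc ⟨b, hb⟩ h
    obtain ⟨hs, hc'⟩ := List.isChain_cons_cons.mp hc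
    have hrec := ih r hc' ⟨b, by simpa using hb⟩ fun x hx => h x (List.mem_cons_of_mem _ hx)
    obtain ⟨hqn, hfq, hq0⟩ := h q (by simp)
    rw [List.map_cons, List.sum_cons]
    have hr : r.1 = q.1 ∨ r.1 = q.1 + 1 := by
      rcases hs with rfl | rfl | rfl <;> simp
    rcases hr with hr | hr
    · rw [hr] at hrec
      linarith
    · rw [hr] at hrec
      rw [← Finset.add_sum_Ioc_eq_sum_Icc hqn, ← Finset.Icc_add_one_left_eq_Ioc]
      linarith

theorem delta_nonneg (x y : ℝ) : 0 ≤ delta x y := sq_nonneg _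

theorem kappa_le_delta {L W : ℕ} (A B : ℕ → ℝ) {i j : ℕ}
    (hj : j ∈ Set.Icc (max 1 (i - W)) (min L (i + W))) :
    kappa L W A B i ≤ delta (A i) (B j) := by
  have hfin : (B '' Set.Icc (max 1 (i - W)) (min L (i + W))).Finite := (Set.finite_Icc _ _).image B
  have hU : B j ≤ upperEnv L W B i := le_csSup hfin.bddAbove ⟨j, hj, rfl⟩
  have hL : lowerEnv L W B i ≤ B j := csInf_le hfin.bddBelow ⟨j, hj, rfl⟩
  unfold kappa
  split_ifs
  · unfold delta
    gcongr
  · unfold delta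
    nlinarith
  · exact delta_nonneg _ _

/-- The diagonal is a warping path for every window size. -/
theorem exists_isWarpingPath {L : ℕ} (W : ℕ) (hL : 1 ≤ L) : ∃ p, IsWarpingPath L W p := by
  induction L, hL using Nat.le_induction with
  | base => exact ⟨[(1, 1)], rfl, rfl, List.isChain_singleton _, by simp⟩
  | succ n _ ih =>
    obtain ⟨p, hhead, hlast, hchain, hmem⟩ := ih
    refine ⟨p ++ [(n + 1, n + 1)], by simp [hhead], by simp, ?_, ?_⟩
    · refine List.IsChain.append hchain (List.isChain_singleton _) ?_
      simp [hlast, Step]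
    · intro q hq
      rcases List.mem_append.mp hq with hq | hq
      · have := hmem q hq
        omega
      · obtain rfl : q = (n + 1, n + 1) := by simpa using hq
        simp

/-- `LB_Keogh_W(A,B) = Σ_{i=1}^{L} κ_i` is a lower bound on `DTW²_W(A,B)`. -/
theorem lbKeogh_lower_bound (L W : ℕ) (hL : 1 ≤ L) (A B : ℕ → ℝ) :
    ∑ i ∈ Finset.Icc 1 L, kappa L W A B i ≤ DTW2 L W A B := by
  obtain ⟨p₀, hp₀⟩ := exists_isWarpingPath W hL
  refine le_csInf ⟨_, p₀, hp₀, rfl⟩ ?_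
  rintro _ ⟨p, ⟨hhead, hlast, hchain, hmem⟩, rfl⟩
  obtain ⟨t, rfl⟩ := List.head?_eq_some_iff.mp hhead
  refine sum_Icc_le_sum_map_of_isChain_step t (1, 1) hchain ⟨L, hlast⟩ fun q hq => ?_
  have hq' := hmem q hq
  exact ⟨hq'.2.1, kappa_le_delta A B (Set.mem_Icc.mpr (by omega)), delta_nonneg _ _⟩
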